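/- For the spherical ensemble of N points on S², the expected pair correlation statistic satisfies E[G_{s,N}] = s²/4 − (1 − (1 − s²/(4N))^N), and hence lim_{N→∞} E[G_{s,N}] = s²/4 − 1 + e^{−s²/4}. -/

import Mathlib

open MeasureTheory Real Filter

open scoped Classical

noncomputable def sphere2 : Set (EuclideanSpace ℝ (Fin 3)) := Metric.sphere 0 1

noncomputable def sigma2 : Measure (EuclideanSpace ℝ (Fin 3)) :=
  (μH[2] sphere2)⁻¹ • (μH[2]).restrict sphere2

/-- Expected pair correlation statistic of the spherical ensemble of N points:
`E[G_{s,N}] = (1/N) ∬ 1[‖p−q‖ ≤ s/√N] · N²(1 − (1 − ‖p−q‖²/4)^{N−1}) dσ(p)dσ(q)`. -/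
noncomputable def Esph (s : ℝ) (N : ℕ) : ℝ :=
  (1 / (N : ℝ)) * ∫ p, ∫ q,
    (if dist p q ≤ s / Real.sqrt N then (1 : ℝ) else 0) *
      ((N : ℝ) ^ 2 * (1 - (1 - dist p q ^ 2 / 4) ^ (N - 1))) ∂sigma2 ∂sigma2

lemma sph_A (F : ℝ → ℝ × ℝ → ENNReal) (hF : Measurable (Function.uncurry F)) :
    ∫⁻ x : EuclideanSpace ℝ (Fin 3), F (x 0) (x 1, x 2) = ∫⁻ z, ∫⁻ p : ℝ × ℝ, F z p := by
  rw [← (PiLp.volume_preserving_toLp (Fin 3)).lintegral_comp_emb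
    (MeasurableEquiv.toLp 2 _).measurableEmbedding]
  have h1 := volume_preserving_piFinSuccAbove (fun _ : Fin 3 => ℝ) 0
  have h2 : MeasurePreserving (Prod.map id (MeasurableEquiv.finTwoArrow : (Fin 2 → ℝ) ≃ᵐ ℝ × ℝ))
      ((volume : Measure ℝ).prod (volume : Measure (Fin 2 → ℝ)))
      ((volume : Measure ℝ).prod (volume : Measure (ℝ × ℝ))) :=
    (MeasurePreserving.id _).prod (volume_preserving_finTwoArrow ℝ)
  have h3 := h2.comp h1
  have := h3.lintegral_comp hF
  rw [lintegral_prod _ hF.aemeasurable] at this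
  exact this

lemma sph_B (H : ℝ → ENNReal) (hH : Measurable H) :
    ∫⁻ p : ℝ × ℝ, H (√(p.1 ^ 2 + p.2 ^ 2)) = ∫⁻ r, ENNReal.ofReal (2 * π * r) * H r := by
  rw [← lintegral_comp_polarCoord_symm, polarCoord_target, Measure.volume_eq_prod,
    ← Measure.prod_restrict]
  have e : ∀ p ∈ Set.Ioi (0:ℝ) ×ˢ Set.Ioo (-π) π,
      ENNReal.ofReal p.1 • H (√((polarCoord.symm p).1 ^ 2 + (polarCoord.symm p).2 ^ 2))
      = (ENNReal.ofReal p.1 * H p.1) * 1 := by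
    rintro ⟨r, θ⟩ ⟨hr, -⟩
    have : √((r * cos θ)^2 + (r * sin θ)^2) = r := by
      rw [show (r * cos θ)^2 + (r * sin θ)^2 = r^2 by nlinarith [sin_sq_add_cos_sq θ]]
      exact Real.sqrt_sq (le_of_lt hr)
    simp [this]
  rw [Measure.prod_restrict, setLIntegral_congr_fun (by measurability) e, ← Measure.prod_restrict,
    lintegral_prod_mul (f := fun r => ENNReal.ofReal r * H r) (g := fun _ => 1)
      (by fun_prop) (by fun_prop)]
  rw [← lintegral_indicator measurableSet_Ioi]
  rw [← lintegral_mul_const _ (by measurability)]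
  congr 1; ext r
  simp only [Set.indicator, Set.mem_Ioi]
  split_ifs with h
  · simp
    rw [show 2 * π * r = r * (π + π) by ring, ENNReal.ofReal_mul h.le]; ring
  · rw [ENNReal.ofReal_of_nonpos (by nlinarith [pi_pos])]; simp

lemma sph_C (f : ℝ → ENNReal) :
    ∫⁻ φ in Set.Ioo (-π) π, ENNReal.ofReal (sin φ) * f (cos φ) = ∫⁻ t in Set.Icc (-1) 1, f t := by
  rw [← bijOn_cos.image_eq, lintegral_image_eq_lintegral_abs_deriv_mul measurableSet_Icc
    (fun x _ => (hasDerivAt_cos x).hasDerivWithinAt) injOn_cos,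
    ← lintegral_indicator measurableSet_Ioo, ← lintegral_indicator measurableSet_Icc]
  congr 1; ext φ
  by_cases h1 : φ ∈ Set.Icc 0 π
  · rw [Set.indicator_of_mem h1, abs_neg, abs_of_nonneg (sin_nonneg_of_mem_Icc h1)]
    by_cases h2 : φ = π
    · subst h2; simp
    · rw [Set.indicator_of_mem]
      exact ⟨by linarith [pi_pos, h1.1], lt_of_le_of_ne h1.2 h2⟩
  · rw [Set.indicator_of_notMem h1]
    by_cases h2 : φ ∈ Set.Ioo (-π) π
    · have : φ ≤ 0 := by
        by_contra h; exact h1 ⟨by linarith, h2.2.le⟩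
      rw [Set.indicator_of_mem h2, ENNReal.ofReal_of_nonpos
        (sin_nonpos_of_nonpos_of_neg_pi_le this h2.1.le), zero_mul]
    · rw [Set.indicator_of_notMem h2]

lemma sph_D : ∃ C : ENNReal, ∀ f : ℝ → ENNReal, Measurable f →
    ∫⁻ x in Metric.ball (0 : EuclideanSpace ℝ (Fin 3)) 1, f (x 0 / ‖x‖)
      = C * ∫⁻ t in Set.Icc (-1) 1, f t := by
  let w : ℝ → ENNReal := Set.indicator (Set.Iio 1) 1
  have hw : Measurable w := measurable_one.indicator measurableSet_Iio
  refine ⟨∫⁻ R in Set.Ioi 0, ENNReal.ofReal R * (ENNReal.ofReal (2 * π * R) * w R), fun f hf => ?_⟩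
  let G : ℝ → ℝ → ENNReal := fun z r => f (z / √(z^2 + r^2)) * w (√(z^2+r^2))
  have hG : Measurable (Function.uncurry G) := by
    simp only [G, Function.uncurry_def]; fun_prop
  have hG' : ∀ z, Measurable (G z) := fun z => hG.comp measurable_prodMk_left
  have e1 : ∫⁻ x in Metric.ball (0 : EuclideanSpace ℝ (Fin 3)) 1, f (x 0 / ‖x‖)
      = ∫⁻ x : EuclideanSpace ℝ (Fin 3), G (x 0) (√(x 1 ^ 2 + x 2 ^ 2)) := by
    rw [← lintegral_indicator measurableSet_ball]
    congr 1; ext x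
    have : √(x 0 ^ 2 + √(x 1 ^ 2 + x 2 ^ 2) ^ 2) = ‖x‖ := by
      rw [Real.sq_sqrt (by positivity), EuclideanSpace.norm_eq]
      simp [Fin.sum_univ_three, add_assoc]
    simp only [G, w, this, Set.indicator, mem_ball_zero_iff, Set.mem_Iio]
    split_ifs <;> simp
  rw [e1, sph_A (fun z p => G z (√(p.1 ^ 2 + p.2 ^ 2)))
    (hG.comp (by fun_prop : Measurable fun q : ℝ × ℝ × ℝ => (q.1, √(q.2.1 ^ 2 + q.2.2 ^ 2))))]
  simp_rw [sph_B _ (hG' _)]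
  rw [← lintegral_prod (f := fun q : ℝ × ℝ => ENNReal.ofReal (2 * π * q.2) * G q.1 q.2)
    (by apply Measurable.aemeasurable; exact (by fun_prop : Measurable fun q : ℝ × ℝ => ENNReal.ofReal (2 * π * q.2)).mul hG),
    ← Measure.volume_eq_prod, ← lintegral_comp_polarCoord_symm, polarCoord_target]
  have e : ∀ p ∈ Set.Ioi (0:ℝ) ×ˢ Set.Ioo (-π) π,
      ENNReal.ofReal p.1 • (ENNReal.ofReal (2 * π * (polarCoord.symm p).2) *
        G (polarCoord.symm p).1 (polarCoord.symm p).2)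
      = (ENNReal.ofReal p.1 * (ENNReal.ofReal (2 * π * p.1) * w p.1)) *
        (ENNReal.ofReal (sin p.2) * f (cos p.2)) := by
    rintro ⟨r, θ⟩ ⟨hr, -⟩
    have hr' : 0 < r := hr
    have : √((r * cos θ)^2 + (r * sin θ)^2) = r := by
      rw [show (r * cos θ)^2 + (r * sin θ)^2 = r^2 by nlinarith [sin_sq_add_cos_sq θ]]
      exact Real.sqrt_sq (le_of_lt hr)
    simp only [polarCoord_symm_apply, G, this, smul_eq_mul]
    rw [mul_div_cancel_left₀ _ hr'.ne', ← mul_assoc (2 * π),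
      ENNReal.ofReal_mul (p := 2 * π * r) (by positivity)]
    ring
  rw [setLIntegral_congr_fun (by measurability) e, Measure.volume_eq_prod, ← Measure.prod_restrict,
    lintegral_prod_mul (f := fun R => ENNReal.ofReal R * (ENNReal.ofReal (2 * π * R) * w R))
      (g := fun φ => ENNReal.ofReal (sin φ) * f (cos φ)) (by fun_prop) (by fun_prop), sph_C]

lemma sphere2_finite : μH[2] sphere2 ≠ ⊤ := by
  let g : (Fin 2 → ℝ) → EuclideanSpace ℝ (Fin 3) := fun u =>
    WithLp.toLp 2 ![cos (u 0), sin (u 0) * cos (u 1), sin (u 0) * sin (u 1)]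
  have hg : ContDiff ℝ 1 g := by
    rw [contDiff_euclidean]
    intro i
    fin_cases i <;> simp [g] <;> fun_prop
  let K : Set (Fin 2 → ℝ) := Set.Icc (fun _ => -π) (fun _ => π)
  obtain ⟨L, hL⟩ := hg.contDiffOn.exists_lipschitzOnWith one_ne_zero
    (convex_Icc _ _ : Convex ℝ K) isCompact_Icc
  have hsub : sphere2 ⊆ g '' K := by
    intro x hx
    have hx' : ‖x‖ = 1 := by simpa [sphere2] using hx
    have hn : x 0 ^ 2 + (x 1 ^ 2 + x 2 ^ 2) = 1 := by
      have := EuclideanSpace.real_norm_sq_eq x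
      rw [hx', Fin.sum_univ_three] at this; linarith
    let c : ℂ := ⟨x 1, x 2⟩
    have hb1 : -1 ≤ x 0 := by nlinarith [sq_nonneg (x 1), sq_nonneg (x 2)]
    have hb2 : x 0 ≤ 1 := by nlinarith [sq_nonneg (x 1), sq_nonneg (x 2)]
    have hc : ‖c‖ = sin (arccos (x 0)) := by
      rw [sin_arccos, Complex.norm_def, Complex.normSq_apply]
      congr 1; simp only [c]; nlinarith
    refine ⟨![arccos (x 0), c.arg], ⟨fun i => ?_, fun i => ?_⟩, ?_⟩
    · fin_cases i
      · simpa using by linarith [arccos_nonneg (x 0), pi_pos]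
      · simpa using (Complex.neg_pi_lt_arg c).le
    · fin_cases i
      · simpa using arccos_le_pi (x 0)
      · simpa using (Complex.arg_le_pi c)
    · ext i
      fin_cases i
      · simp [g, cos_arccos hb1 hb2]
      · simp only [g]; simp [← hc, Complex.norm_mul_cos_arg]; rfl
      · simp only [g]; simp [← hc, Complex.norm_mul_sin_arg]; rfl
  refine ne_top_of_le_ne_top ?_ ((measure_mono hsub).trans
    (hL.hausdorffMeasure_image_le (by norm_num)))
  have hv : (μH[2] : Measure (Fin 2 → ℝ)) = volume := by
    simpa using hausdorffMeasure_pi_real (ι := Fin 2)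
  rw [hv]
  exact ENNReal.mul_ne_top (by simp) (isCompact_Icc.measure_lt_top.ne)

lemma sphere2_pos : μH[2] sphere2 ≠ 0 := by
  let g : EuclideanSpace ℝ (Fin 3) → (Fin 2 → ℝ) := fun x => ![x 0, x 1]
  have hg : LipschitzWith 1 g := by
    apply LipschitzWith.of_dist_le_mul
    intro x y
    rw [NNReal.coe_one, one_mul, dist_pi_le_iff dist_nonneg]
    intro i
    fin_cases i
    · simpa [g, dist_eq_norm] using PiLp.norm_apply_le (x - y) 0
    · simpa [g, dist_eq_norm] using PiLp.norm_apply_le (x - y) 1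
  let K : Set (Fin 2 → ℝ) := Set.Icc (fun _ => 0) (fun _ => 1/2)
  have hsub : K ⊆ g '' sphere2 := by
    intro u hu
    have a0 := hu.1 0
    have a1 := hu.1 1
    have b0 := hu.2 0
    have b1 := hu.2 1
    simp only at a0 a1 b0 b1
    refine ⟨WithLp.toLp 2 ![u 0, u 1, √(1 - u 0 ^ 2 - u 1 ^ 2)], ?_, ?_⟩
    · simp only [sphere2, mem_sphere_zero_iff_norm]
      rw [EuclideanSpace.norm_eq, Real.sqrt_eq_one]
      simp [Fin.sum_univ_three]
      rw [Real.sq_sqrt (by nlinarith)]; ring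
    · ext i; fin_cases i <;> simp [g]
  intro h0
  have h := (measure_mono hsub).trans (hg.hausdorffMeasure_image_le (d := 2) (by norm_num) sphere2)
  have hv : (μH[2] : Measure (Fin 2 → ℝ)) = volume := by
    simpa using hausdorffMeasure_pi_real (ι := Fin 2)
  rw [h0, hv, mul_zero] at h
  simp [K, Real.volume_Icc_pi] at h

instance sigma2_prob : IsProbabilityMeasure sigma2 := by
  constructor
  simp [sigma2, ENNReal.inv_mul_cancel sphere2_pos sphere2_finite]

lemma sigma2_ae : ∀ᵐ q ∂sigma2, ‖q‖ = 1 := by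
  apply Measure.ae_smul_measure
  have : MeasurableSet sphere2 := Metric.isClosed_sphere.measurableSet
  filter_upwards [ae_restrict_mem this] with q hq
  simpa [sphere2] using hq

lemma sigma2_inv (R : EuclideanSpace ℝ (Fin 3) ≃ₗᵢ[ℝ] EuclideanSpace ℝ (Fin 3)) :
    MeasurePreserving R sigma2 sigma2 := by
  have h : MeasurePreserving R μH[2] μH[2] := R.toIsometryEquiv.measurePreserving_hausdorffMeasure 2
  have h2 := h.restrict_preimage (s := sphere2) Metric.isClosed_sphere.measurableSet
  have h3 : R ⁻¹' sphere2 = sphere2 := by ext x; simp [sphere2]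
  rw [h3] at h2
  exact h2.smul_measure _

lemma exists_rot (p q : EuclideanSpace ℝ (Fin 3)) (h : ‖p‖ = ‖q‖) :
    ∃ R : EuclideanSpace ℝ (Fin 3) ≃ₗᵢ[ℝ] EuclideanSpace ℝ (Fin 3), R p = q :=
  ⟨_, Submodule.reflection_sub h⟩

lemma inv_const {μ : Measure (EuclideanSpace ℝ (Fin 3))}
    (hμ : ∀ R : EuclideanSpace ℝ (Fin 3) ≃ₗᵢ[ℝ] EuclideanSpace ℝ (Fin 3), MeasurePreserving R μ μ)
    (f : ℝ → ENNReal) (p q : EuclideanSpace ℝ (Fin 3)) (h : ‖p‖ = ‖q‖) :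
    ∫⁻ x, f (inner ℝ p x / ‖x‖) ∂μ = ∫⁻ x, f (inner ℝ q x / ‖x‖) ∂μ := by
  obtain ⟨R, hR⟩ := exists_rot p q h
  symm
  rw [← (hμ R).lintegral_comp_emb R.toHomeomorph.measurableEmbedding]
  subst hR
  simp

lemma sigma2_law (p : EuclideanSpace ℝ (Fin 3)) (hp : ‖p‖ = 1) (f : ℝ → ENNReal)
    (hf : Measurable f) :
    ∫⁻ q, f (inner ℝ p q) ∂sigma2 = 2⁻¹ * ∫⁻ t in Set.Icc (-1) 1, f t := by
  obtain ⟨C, hC⟩ := sph_D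
  let B := Metric.ball (0 : EuclideanSpace ℝ (Fin 3)) 1
  let ν : Measure (EuclideanSpace ℝ (Fin 3)) := volume.restrict B
  let e : EuclideanSpace ℝ (Fin 3) := EuclideanSpace.single 0 1
  have he : ‖e‖ = 1 := by simp [e]
  have hν : ∀ R : EuclideanSpace ℝ (Fin 3) ≃ₗᵢ[ℝ] EuclideanSpace ℝ (Fin 3),
      MeasurePreserving R ν ν := by
    intro R
    have h2 := R.measurePreserving.restrict_preimage (s := B) measurableSet_ball
    have h3 : R ⁻¹' B = B := by ext x; simp [B]
    rwa [h3] at h2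
  have hB : volume B = C * 2 := by
    have := hC (fun _ => 1) measurable_const
    rw [setLIntegral_const, setLIntegral_const, one_mul, one_mul, Real.volume_Icc] at this
    change volume B = _ at this
    rw [this]; norm_num
  have hB0 : volume B ≠ 0 := (Metric.measure_ball_pos _ _ one_pos).ne'
  have hB1 : volume B ≠ ⊤ := measure_ball_lt_top.ne
  have hL : ∀ q : EuclideanSpace ℝ (Fin 3), ‖q‖ = 1 →
      ∫⁻ x, f (inner ℝ q x / ‖x‖) ∂ν = C * ∫⁻ t in Set.Icc (-1) 1, f t := by
    intro q hq
    rw [inv_const hν f q e (by rw [hq, he]), ← hC f hf]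
    simp [ν, B, e, EuclideanSpace.inner_single_left]
  have hS : ∀ x : EuclideanSpace ℝ (Fin 3), x ≠ 0 →
      ∫⁻ q, f (inner ℝ q x / ‖x‖) ∂sigma2 = ∫⁻ q, f (inner ℝ p q) ∂sigma2 := by
    intro x hx
    have hx' : ‖‖x‖⁻¹ • x‖ = 1 := by simp [norm_smul, hx]
    have := inv_const sigma2_inv f (‖x‖⁻¹ • x) p (by rw [hx', hp])
    have e1 : ∫⁻ q, f (inner ℝ q x / ‖x‖) ∂sigma2
        = ∫⁻ q, f (inner ℝ (‖x‖⁻¹ • x) q / ‖q‖) ∂sigma2 := by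
      apply lintegral_congr_ae
      filter_upwards [sigma2_ae] with q hq
      rw [hq, div_one, real_inner_smul_left, real_inner_comm, div_eq_inv_mul]
    rw [e1, this]
    apply lintegral_congr_ae
    filter_upwards [sigma2_ae] with q hq
    rw [hq, div_one]
  have hm : Measurable (Function.uncurry fun (x q : EuclideanSpace ℝ (Fin 3)) =>
      f (inner ℝ q x / ‖x‖)) := by
    apply hf.comp
    fun_prop
  have hsw := lintegral_lintegral_swap (μ := ν) (ν := sigma2) hm.aemeasurable
  have l1 : ∫⁻ x, ∫⁻ q, f (inner ℝ q x / ‖x‖) ∂sigma2 ∂ν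
      = (∫⁻ q, f (inner ℝ p q) ∂sigma2) * volume B := by
    have : ∀ᵐ x ∂ν, x ≠ 0 := by
      apply ae_restrict_of_ae
      simp [ae_iff]
    rw [lintegral_congr_ae (this.mono fun x hx => hS x hx)]
    simp [ν]
  have l2 : ∫⁻ q, ∫⁻ x, f (inner ℝ q x / ‖x‖) ∂ν ∂sigma2 = C * ∫⁻ t in Set.Icc (-1) 1, f t := by
    rw [lintegral_congr_ae (sigma2_ae.mono fun q hq => hL q hq)]
    simp
  rw [l1, l2] at hsw
  have hC2 : C = 2⁻¹ * volume B := by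
    rw [hB, mul_comm, mul_assoc, ENNReal.mul_inv_cancel (by simp) (by simp), mul_one]
  rw [hC2] at hsw
  apply (ENNReal.mul_left_inj hB0 hB1).1
  rw [hsw]; ring

lemma sigma2_map (p : EuclideanSpace ℝ (Fin 3)) (hp : ‖p‖ = 1) :
    sigma2.map (fun q => inner ℝ p q) = (2⁻¹ : ENNReal) • (volume.restrict (Set.Icc (-1 : ℝ) 1)) := by
  have hm : Measurable (fun q : EuclideanSpace ℝ (Fin 3) => inner ℝ p q) := by fun_prop
  ext s hs
  have := sigma2_law p hp (s.indicator 1) (measurable_one.indicator hs)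
  rw [lintegral_indicator_one hs] at this
  rw [Measure.smul_apply, smul_eq_mul, ← this, ← lintegral_map (measurable_one.indicator hs) hm,
    lintegral_indicator_one hs]

lemma sigma2_integral (p : EuclideanSpace ℝ (Fin 3)) (hp : ‖p‖ = 1) (g : ℝ → ℝ)
    (hg : Measurable g) :
    ∫ q, g (inner ℝ p q) ∂sigma2 = 2⁻¹ * ∫ t in Set.Icc (-1) 1, g t := by
  have hm : Measurable (fun q : EuclideanSpace ℝ (Fin 3) => inner ℝ p q) := by fun_prop
  rw [← integral_map hm.aemeasurable hg.aestronglyMeasurable, sigma2_map p hp,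
    integral_smul_measure]
  simp

lemma Esph_eq (s : ℝ) (hs : 0 ≤ s) (N : ℕ) (hN : 1 ≤ N) (hsN : s ^ 2 ≤ 4 * N) :
    Esph s N = s ^ 2 / 4 - (1 - (1 - s ^ 2 / (4 * N)) ^ N) := by
  have hN0 : (0 : ℝ) < N := by exact_mod_cast hN
  let h : ℝ → ℝ := fun t => (N : ℝ) ^ 2 * (1 - ((1 + t) / 2) ^ (N - 1))
  let a : ℝ := 1 - s ^ 2 / (2 * N)
  have ha : -1 ≤ a := by
    have : s ^ 2 / (2 * N) ≤ 2 := by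
      rw [div_le_iff₀ (by positivity)]; linarith
    simp only [a]; linarith
  have ha1 : a ≤ 1 := by
    have : 0 ≤ s ^ 2 / (2 * N) := by positivity
    simp only [a]; linarith
  let g : ℝ → ℝ := (Set.Ici a).indicator h
  have hh : Continuous h := by fun_prop
  have hg : Measurable g := hh.measurable.indicator measurableSet_Ici
  have key : ∀ p : EuclideanSpace ℝ (Fin 3), ‖p‖ = 1 →
      ∫ q, (if dist p q ≤ s / Real.sqrt N then (1 : ℝ) else 0) *
      ((N : ℝ) ^ 2 * (1 - (1 - dist p q ^ 2 / 4) ^ (N - 1))) ∂sigma2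
      = 2⁻¹ * ∫ t in a..1, h t := by
    intro p hp
    have : ∫ t in a..1, h t = ∫ t in Set.Icc (-1) 1, g t := by
      rw [intervalIntegral.integral_of_le ha1, ← integral_Icc_eq_integral_Ioc,
        setIntegral_indicator measurableSet_Ici]
      congr 2
      ext t; simp; grind
    rw [this, ← sigma2_integral p hp g hg]
    apply integral_congr_ae
    filter_upwards [sigma2_ae] with q hq
    have hd : dist p q ^ 2 = 2 - 2 * inner ℝ p q := by
      rw [dist_eq_norm, norm_sub_sq_real, hp, hq]; ring
    have hiff : dist p q ≤ s / √N ↔ a ≤ inner ℝ p q := by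
      rw [← sq_le_sq₀ dist_nonneg (by positivity), hd, div_pow, Real.sq_sqrt hN0.le]
      have : s ^ 2 / (2 * N) = s ^ 2 / N / 2 := by field_simp
      simp only [a, this]
      constructor <;> intro <;> linarith
    simp only [g, Set.indicator, Set.mem_Ici, hiff, hd, h]
    split_ifs
    · rw [one_mul]; congr 3; ring
    · simp
  have hint : ∫ t in a..1, h t = 2 * (N * (s ^ 2 / 4 - (1 - (1 - s ^ 2 / (4 * N)) ^ N))) := by
    have hder : ∀ t ∈ Set.uIcc a 1, HasDerivAt (fun t : ℝ => (N : ℝ) ^ 2 * t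
        - 2 * N * ((1 + t) / 2) ^ N) (h t) t := by
      intro t _
      have h1 : HasDerivAt (fun t : ℝ => (1 + t) / 2) (1 / 2) t :=
        ((hasDerivAt_id t).const_add 1).div_const 2
      have h2 := ((hasDerivAt_id t).const_mul ((N : ℝ) ^ 2)).sub ((h1.pow N).const_mul (2 * (N : ℝ)))
      refine h2.congr_deriv ?_
      simp only [h]; ring
    rw [intervalIntegral.integral_eq_sub_of_hasDerivAt hder (hh.intervalIntegrable _ _)]
    have : (1 + a) / 2 = 1 - s ^ 2 / (4 * N) := by simp only [a]; field_simp; ring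
    rw [this]
    simp only [a]
    norm_num
    field_simp
    ring
  unfold Esph
  rw [integral_congr_ae (sigma2_ae.mono fun p hp => key p hp), hint]
  simp
  field_simp

theorem spherical_ensemble_pair_correlation (s : ℝ) (hs : 0 ≤ s) :
    (∀ N : ℕ, 1 ≤ N → s ^ 2 ≤ 4 * N →
      Esph s N = s ^ 2 / 4 - (1 - (1 - s ^ 2 / (4 * N)) ^ N)) ∧
    Tendsto (fun N : ℕ => Esph s N) atTop
      (nhds (s ^ 2 / 4 - 1 + Real.exp (-s ^ 2 / 4))) := by
  refine ⟨fun N hN h => Esph_eq s hs N hN h, ?_⟩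
  have h1 := (Real.tendsto_one_add_div_pow_exp (-s ^ 2 / 4)).const_add (s ^ 2 / 4 - 1)
  refine h1.congr' ?_
  filter_upwards [eventually_ge_atTop 1, eventually_ge_atTop ⌈s ^ 2⌉₊] with N hN hN2
  have hN0 : (0 : ℝ) < N := by exact_mod_cast hN
  have : s ^ 2 ≤ N := (Nat.le_ceil _).trans (by exact_mod_cast hN2)
  rw [Esph_eq s hs N hN (by linarith)]
  have : 1 + -s ^ 2 / 4 / N = 1 - s ^ 2 / (4 * N) := by field_simp; ring
  rw [this]; ring
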